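/- arXiv:math/0402038 — 4 statements merged into one kernel-verified Lean document; each statement's English description precedes it below -/
import Mathlib

section
/- Let d ≥ 1, let b : ℝ^d × ℝ^d → ℂ be smooth and ℤ^d-periodic in its second variable, let h ∈ C_c^∞(ℝ^d; ℂ), let g : ℝ^d → ℝ^d be smooth, and let ω : ℝ^d → ℝ^d be smooth such that the Jacobian matrix Dω(I) is invertible for every I in the support of h (non-degeneracy). Then there exists C > 0 such that for all t ∈ ℝ, |∫_{ℝ^d} b(I, g(I) + t ω(I)) h(I) dI − ∫_{ℝ^d} (∫_{[0,1]^d} b(I,x) dx) h(I) dI| ≤ C/(1 + |t|). (This is the classical dynamical content of Theorem 1.2(ii): for a family of invariant tori with non-degenerate frequency map, transported observables integrated against a density transversal to the foliation converge, at rate 1/t, to the torus averages of the observable weighted by the density.) -/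
open MeasureTheory Real

/-- A continuous function that is `ℤ^d`-periodic in its second variable is bounded, uniformly when
the first variable stays in a compact set. -/
theorem exists_norm_le_of_periodic_snd {d : ℕ} {V : Type*} [NormedAddCommGroup V]
    {f : (Fin d → ℝ) × (Fin d → ℝ) → V} (hf : Continuous f)
    (hper : ∀ (I x : Fin d → ℝ) (m : Fin d → ℤ), f (I, x + fun i => (m i : ℝ)) = f (I, x))
    {K : Set (Fin d → ℝ)} (hK : IsCompact K) :
    ∃ M : ℝ, 0 ≤ M ∧ ∀ I ∈ K, ∀ x, ‖f (I, x)‖ ≤ M := by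
  obtain ⟨M, hM⟩ := (hK.prod
    (isCompact_Icc (a := (0 : Fin d → ℝ)) (b := 1))).exists_bound_of_continuousOn hf.continuousOn
  refine ⟨max M 0, le_max_right _ _, fun I hI x => le_max_of_le_left ?_⟩
  have hx := hper I (fun i => Int.fract (x i)) (fun i => ⌊x i⌋)
  have hx' : ((fun i => Int.fract (x i)) + fun i => (⌊x i⌋ : ℝ)) = x := by
    ext i
    simp
  rw [hx'] at hx
  rw [hx]
  exact hM _ ⟨hI, fun i => Int.fract_nonneg _, fun i => (Int.fract_lt_one _).le⟩

/-- The derivative of a function periodic in its second variable is periodic in its second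
variable. -/
theorem fderiv_periodic_snd {d : ℕ} {V : Type*} [NormedAddCommGroup V] [NormedSpace ℝ V]
    {f : (Fin d → ℝ) × (Fin d → ℝ) → V}
    (hper : ∀ (I x : Fin d → ℝ) (m : Fin d → ℤ), f (I, x + fun i => (m i : ℝ)) = f (I, x))
    (I x : Fin d → ℝ) (m : Fin d → ℤ) :
    fderiv ℝ f (I, x + fun i => (m i : ℝ)) = fderiv ℝ f (I, x) := by
  have h1 : (fun p => f (p + ((0 : Fin d → ℝ), fun i => (m i : ℝ)))) = f := by
    ext ⟨J, y⟩
    simpa using hper J y m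
  have h2 := fderiv_comp_add_right (𝕜 := ℝ) (f := f) (x := (I, x))
    ((0 : Fin d → ℝ), fun i => (m i : ℝ))
  rw [h1] at h2
  simpa using h2.symm

/-- The integral of a `ℤ^d`-periodic function over the unit cube is invariant under translation. -/
theorem setIntegral_Icc_add_left_of_periodic {d : ℕ} {V : Type*} [NormedAddCommGroup V]
    [NormedSpace ℝ V] {f : (Fin d → ℝ) → V}
    (hper : ∀ (x : Fin d → ℝ) (m : Fin d → ℤ), f (x + fun i => (m i : ℝ)) = f x)
    (z : Fin d → ℝ) :
    ∫ y in Set.Icc (0 : Fin d → ℝ) 1, f (z + y) = ∫ y in Set.Icc (0 : Fin d → ℝ) 1, f y := by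
  have hae : ZSpan.fundamentalDomain (Pi.basisFun ℝ (Fin d)) =ᵐ[volume]
      Set.Icc (0 : Fin d → ℝ) 1 := by
    rw [ZSpan.fundamentalDomain_pi_basisFun]
    exact Measure.univ_pi_Ico_ae_eq_Icc
  rw [← setIntegral_congr_set hae, ← setIntegral_congr_set hae]
  have : Countable (Submodule.span ℤ (Set.range (Pi.basisFun ℝ (Fin d)))).toAddSubgroup :=
    inferInstanceAs (Countable (Submodule.span ℤ (Set.range (Pi.basisFun ℝ (Fin d)))))
  have hD := ZSpan.isAddFundamentalDomain' (Pi.basisFun ℝ (Fin d)) volume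
  have key := (hD.vadd_of_comm z).setIntegral_eq hD (f := f) (by
    rintro ⟨g, hg⟩ x
    have hg' := ((Pi.basisFun ℝ (Fin d)).mem_span_iff_repr_mem ℤ g).1 hg
    choose m hm using hg'
    have : g = fun i => (m i : ℝ) := by
      ext i
      simpa using (hm i).symm
    subst this
    rw [← hper x m, add_comm x]
    rfl)
  rw [← key]
  have hmp : MeasurePreserving (fun y : Fin d → ℝ => z + y) volume volume :=
    measurePreserving_add_left volume z
  rw [← hmp.setIntegral_image_emb (measurableEmbedding_addLeft z)]
  rfl

/-- Where `Dω` is invertible on the support of `h`, the constant vector `y` weighted by `h` is the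
image under `Dω` of a compactly supported smooth vector field, with coordinates `u k`. -/
theorem exists_smooth_preimage_of_bijective_fderiv {d : ℕ}
    {h : (Fin d → ℝ) → ℂ} (hh : ContDiff ℝ (⊤ : ℕ∞) h)
    {ω : (Fin d → ℝ) → (Fin d → ℝ)} (hω : ContDiff ℝ (⊤ : ℕ∞) ω)
    (hnondeg : ∀ I ∈ tsupport h, Function.Bijective (fderiv ℝ ω I)) (y : Fin d → ℝ) :
    ∃ u : Fin d → (Fin d → ℝ) → ℂ, (∀ k, ContDiff ℝ 1 (u k)) ∧
      (∀ k, tsupport (u k) ⊆ tsupport h) ∧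
      ∀ (L : (Fin d → ℝ) →L[ℝ] ℂ) (I : Fin d → ℝ),
        ∑ k, u k I * L (fderiv ℝ ω I (Pi.single k 1)) = h I * L y := by
  have hinv : ∀ I ∈ tsupport h, (fderiv ℝ ω I).IsInvertible := by
    intro I hI
    have hb := hnondeg I hI
    exact ⟨ContinuousLinearEquiv.ofBijective (fderiv ℝ ω I) (LinearMap.ker_eq_bot.2 hb.1)
      (LinearMap.range_eq_top.2 hb.2), by ext; simp⟩
  refine ⟨fun k I => h I * (((fderiv ℝ ω I).inverse y k : ℝ) : ℂ), fun k => ?_, fun k => ?_, ?_⟩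
  · refine contDiff_iff_contDiffAt.2 fun I => ?_
    by_cases hI : I ∈ tsupport h
    · have h1 : ContDiffAt ℝ 1 (fun I => (fderiv ℝ ω I).inverse) I :=
        (hinv I hI).contDiffAt_map_inverse.comp I
          ((hω.fderiv_right (m := 1) (by norm_cast)).contDiffAt)
      have h2 : ContDiffAt ℝ 1 (fun I => (fderiv ℝ ω I).inverse y) I :=
        h1.clm_apply contDiffAt_const
      exact (hh.contDiffAt.of_le (by exact_mod_cast le_top)).mul
        (Complex.ofRealCLM.contDiff.contDiffAt.comp I (contDiffAt_pi.1 h2 k))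
    · refine (contDiffAt_const (c := (0 : ℂ))).congr_of_eventuallyEq ?_
      filter_upwards [notMem_tsupport_iff_eventuallyEq.1 hI] with J hJ
      simp [hJ]
  · exact tsupport_mul_subset_left
  · intro L I
    by_cases hI : I ∈ tsupport h
    · have h1 : fderiv ℝ ω I ((fderiv ℝ ω I).inverse y) = y := by
        obtain ⟨e, he⟩ := hinv I hI
        rw [← he]
        simp
      conv_rhs => rw [← h1, ← Finset.univ_sum_single ((fderiv ℝ ω I).inverse y)]
      rw [map_sum, map_sum, Finset.mul_sum]
      refine Finset.sum_congr rfl fun k _ => ?_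
      have : (Pi.single k ((fderiv ℝ ω I).inverse y k) : Fin d → ℝ)
          = ((fderiv ℝ ω I).inverse y k) • Pi.single k 1 := by
        rw [← Pi.single_smul]
        simp
      rw [this, map_smul, map_smul, Complex.real_smul]
      ring
    · simp [image_eq_zero_of_notMem_tsupport hI]

/-- Non-stationary phase along the directions `y` of the torus: one integration by parts gains a
factor `1 / t`, uniformly in the translation `w` on the torus. -/
theorem exists_norm_mul_integral_fderiv_snd_le {d : ℕ}
    {b : (Fin d → ℝ) × (Fin d → ℝ) → ℂ} (hb : ContDiff ℝ (⊤ : ℕ∞) b)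
    (hbper : ∀ (I x : Fin d → ℝ) (m : Fin d → ℤ), b (I, x + fun i => (m i : ℝ)) = b (I, x))
    {h : (Fin d → ℝ) → ℂ} (hh : ContDiff ℝ (⊤ : ℕ∞) h) (hhc : HasCompactSupport h)
    {g : (Fin d → ℝ) → (Fin d → ℝ)} (hg : ContDiff ℝ (⊤ : ℕ∞) g)
    {ω : (Fin d → ℝ) → (Fin d → ℝ)} (hω : ContDiff ℝ (⊤ : ℕ∞) ω)
    (hnondeg : ∀ I ∈ tsupport h, Function.Bijective (fderiv ℝ ω I)) (y : Fin d → ℝ) :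
    ∃ C : ℝ, ∀ (t : ℝ) (w : Fin d → ℝ),
      ‖(t : ℂ) * ∫ I, fderiv ℝ b (I, g I + t • ω I + w) (0, y) * h I‖ ≤ C := by
  obtain ⟨u, hu, husupp, huL⟩ := exists_smooth_preimage_of_bijective_fderiv hh hω hnondeg y
  have hdb : Continuous (fderiv ℝ b) := hb.continuous_fderiv (by simp)
  have hdg : Continuous (fderiv ℝ g) := hg.continuous_fderiv (by simp)
  obtain ⟨M, _, hM⟩ := exists_norm_le_of_periodic_snd hb.continuous hbper hhc
  obtain ⟨N, _, hN⟩ := exists_norm_le_of_periodic_snd hdb (fderiv_periodic_snd hbper) hhc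
  have huc : ∀ k, HasCompactSupport (u k) := fun k => hhc.of_isClosed_subset
    (isClosed_tsupport _) (husupp k)
  have hducont : ∀ k, Continuous fun I => fderiv ℝ (u k) I (Pi.single k 1) := fun k =>
    ((hu k).continuous_fderiv (by simp)).clm_apply continuous_const
  have hduc : ∀ k, HasCompactSupport fun I => fderiv ℝ (u k) I (Pi.single k 1) := fun k =>
    (huc k).fderiv_apply ℝ _
  let e : Fin d → Fin d → ℝ := fun k => Pi.single k 1
  let β : Fin d → (Fin d → ℝ) → ℝ := fun k I =>
    M * ‖fderiv ℝ (u k) I (e k)‖ + N * ‖(e k, fderiv ℝ g I (e k))‖ * ‖u k I‖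
  have hβ : ∀ k, Integrable (β k) := fun k => by
    refine Integrable.add ?_ ?_
    · exact (((hducont k).integrable_of_hasCompactSupport (hduc k)).norm.const_mul M)
    · refine Continuous.integrable_of_hasCompactSupport ?_ ?_
      · have := (hu k).continuous
        fun_prop
      · exact (huc k).norm.mul_left
  refine ⟨∑ k, ∫ I, β k I, fun t w => ?_⟩
  let z : (Fin d → ℝ) → (Fin d → ℝ) := fun I => g I + t • ω I + w
  let Φ : (Fin d → ℝ) → ℂ := fun I => b (I, z I)
  have hz : ContDiff ℝ (⊤ : ℕ∞) z := (hg.add (hω.const_smul t)).add contDiff_const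
  have hΦ : ContDiff ℝ (⊤ : ℕ∞) Φ := hb.comp (contDiff_id.prodMk hz)
  have hΦ' : ∀ I v, fderiv ℝ Φ I v = fderiv ℝ b (I, z I) (v, fderiv ℝ g I v)
      + t * fderiv ℝ b (I, z I) (0, fderiv ℝ ω I v) := by
    intro I v
    have h1 : HasFDerivAt z (fderiv ℝ g I + t • fderiv ℝ ω I) I :=
      (((hg.differentiable (by simp)) I).hasFDerivAt.add
        (((hω.differentiable (by simp)) I).hasFDerivAt.const_smul t)).add_const w
    have h2 : HasFDerivAt Φ _ I :=
      ((hb.differentiable (by simp)) (I, z I)).hasFDerivAt.comp I ((hasFDerivAt_id I).prodMk h1)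
    rw [h2.fderiv]
    have h3 : ((v, fderiv ℝ g I v + t • fderiv ℝ ω I v) : (Fin d → ℝ) × (Fin d → ℝ))
        = (v, fderiv ℝ g I v) + t • (0, fderiv ℝ ω I v) := by simp
    calc _ = fderiv ℝ b (I, z I) (v, fderiv ℝ g I v + t • fderiv ℝ ω I v) := by simp
      _ = _ := by rw [h3, map_add, map_smul, Complex.real_smul]
  have hid : ∀ I, (t : ℂ) * (fderiv ℝ b (I, z I) (0, y) * h I)
      = ∑ k, (u k I * fderiv ℝ Φ I (e k)
        - u k I * fderiv ℝ b (I, z I) (e k, fderiv ℝ g I (e k))) := by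
    intro I
    have h1 := huL ((fderiv ℝ b (I, z I)).comp (ContinuousLinearMap.inr ℝ _ _)) I
    simp only [ContinuousLinearMap.comp_apply, ContinuousLinearMap.inr_apply] at h1
    rw [mul_comm _ (h I), ← h1, Finset.mul_sum]
    refine Finset.sum_congr rfl fun k _ => ?_
    rw [hΦ']
    ring
  have hzc := hz.continuous
  have hΦc := hΦ.continuous
  have hdΦ : Continuous (fderiv ℝ Φ) := hΦ.continuous_fderiv (by simp)
  have i1 : ∀ k, Integrable fun I => u k I * fderiv ℝ Φ I (e k) := fun k => by
    have := (hu k).continuous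
    exact Continuous.integrable_of_hasCompactSupport (by fun_prop) (huc k).mul_right
  have i2 : ∀ k, Integrable fun I => u k I * fderiv ℝ b (I, z I) (e k, fderiv ℝ g I (e k)) :=
    fun k => by
      have := (hu k).continuous
      exact Continuous.integrable_of_hasCompactSupport (by fun_prop) (huc k).mul_right
  have i3 : ∀ k, Integrable fun I => fderiv ℝ (u k) I (e k) * Φ I := fun k =>
    Continuous.integrable_of_hasCompactSupport ((hducont k).mul hΦc) (hduc k).mul_right
  have i4 : ∀ k, Integrable fun I => u k I * Φ I := fun k =>
    Continuous.integrable_of_hasCompactSupport ((hu k).continuous.mul hΦc) (huc k).mul_right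
  rw [← integral_const_mul]
  simp_rw [show ∀ I, g I + t • ω I + w = z I from fun I => rfl, hid]
  rw [integral_finsetSum _ (by exact fun k _ => (i1 k).sub (i2 k))]
  refine (norm_sum_le _ _).trans (Finset.sum_le_sum fun k _ => ?_)
  have i5 : Integrable fun I => -(fderiv ℝ (u k) I (e k) * Φ I) := (i3 k).neg
  rw [integral_sub (i1 k) (i2 k), integral_mul_fderiv_eq_neg_fderiv_mul_of_integrable (i3 k) (i1 k)
    (i4 k) (fun I _ => (hu k).differentiable (by simp) I)
    (fun I _ => hΦ.differentiable (by simp) I), ← integral_neg, ← integral_sub i5 (i2 k)]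
  refine norm_integral_le_of_norm_le (hβ k) (ae_of_all _ fun I => ?_)
  by_cases hI : I ∈ tsupport (u k)
  · have hI' := husupp k hI
    refine (norm_sub_le _ _).trans (add_le_add ?_ ?_)
    · rw [norm_neg, norm_mul, mul_comm]
      exact mul_le_mul_of_nonneg_right (hM I hI' _) (norm_nonneg _)
    · rw [norm_mul, mul_comm]
      refine mul_le_mul_of_nonneg_right ?_ (norm_nonneg _)
      exact ContinuousLinearMap.le_of_opNorm_le _ (hN I hI' _) _
  · have h1 : fderiv ℝ (u k) I = 0 :=
      image_eq_zero_of_notMem_tsupport fun hc => hI (tsupport_fderiv_subset ℝ hc)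
    simp [h1, image_eq_zero_of_notMem_tsupport hI, β]

/-- Averages over the torus of the transported observable do not depend on the transport. -/
theorem setIntegral_integral_transport_eq {d : ℕ}
    {b : (Fin d → ℝ) × (Fin d → ℝ) → ℂ} (hb : Continuous b)
    (hbper : ∀ (I x : Fin d → ℝ) (m : Fin d → ℤ), b (I, x + fun i => (m i : ℝ)) = b (I, x))
    {h : (Fin d → ℝ) → ℂ} (hh : Continuous h) (hhc : HasCompactSupport h)
    {z : (Fin d → ℝ) → (Fin d → ℝ)} (hz : Continuous z) :
    Integrable (fun y => ∫ I, b (I, z I + y) * h I)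
        (volume.restrict (Set.Icc (0 : Fin d → ℝ) 1)) ∧
      ∫ y in Set.Icc (0 : Fin d → ℝ) 1, ∫ I, b (I, z I + y) * h I
        = ∫ I, (∫ x in Set.Icc (0 : Fin d → ℝ) 1, b (I, x)) * h I := by
  obtain ⟨M, _, hM⟩ := exists_norm_le_of_periodic_snd hb hbper hhc
  have hint : Integrable (Function.uncurry fun (y I : Fin d → ℝ) => b (I, z I + y) * h I)
      ((volume.restrict (Set.Icc (0 : Fin d → ℝ) 1)).prod volume) := by
    have h1 : Integrable (fun p : (Fin d → ℝ) × (Fin d → ℝ) => M * ‖h p.2‖)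
        ((volume.restrict (Set.Icc (0 : Fin d → ℝ) 1)).prod volume) :=
      have : IsFiniteMeasure (volume.restrict (Set.Icc (0 : Fin d → ℝ) 1)) :=
        ⟨by simpa using isCompact_Icc.measure_lt_top⟩
      ((hh.integrable_of_hasCompactSupport hhc).norm.const_mul M).comp_snd _
    refine h1.mono' (Continuous.aestronglyMeasurable ?_) (ae_of_all _ fun ⟨y, I⟩ => ?_)
    · unfold Function.uncurry
      fun_prop
    · simp only [Function.uncurry, norm_mul]
      by_cases hI : I ∈ tsupport h
      · exact mul_le_mul_of_nonneg_right (hM I hI _) (norm_nonneg _)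
      · simp [image_eq_zero_of_notMem_tsupport hI]
  refine ⟨hint.integral_prod_left, ?_⟩
  rw [integral_integral_swap hint]
  refine integral_congr_ae (ae_of_all _ fun I => ?_)
  simp only
  rw [integral_mul_const, setIntegral_Icc_add_left_of_periodic (f := fun x => b (I, x)) (hbper I)]

/-- The transported observable, translated by `y` on the torus, has `y`-derivative along a segment
given by the integral of the derivative of the observable in the torus variable. -/
theorem hasDerivAt_integral_transport {d : ℕ}
    {b : (Fin d → ℝ) × (Fin d → ℝ) → ℂ} (hb : ContDiff ℝ (⊤ : ℕ∞) b)
    (hbper : ∀ (I x : Fin d → ℝ) (m : Fin d → ℤ), b (I, x + fun i => (m i : ℝ)) = b (I, x))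
    {h : (Fin d → ℝ) → ℂ} (hh : Continuous h) (hhc : HasCompactSupport h)
    {z : (Fin d → ℝ) → (Fin d → ℝ)} (hz : Continuous z) (y : Fin d → ℝ) (s : ℝ) :
    HasDerivAt (fun s : ℝ => ∫ I, b (I, z I + s • y) * h I)
      (∫ I, fderiv ℝ b (I, z I + s • y) (0, y) * h I) s := by
  have hbc := hb.continuous
  have hdb : Continuous (fderiv ℝ b) := hb.continuous_fderiv (by simp)
  obtain ⟨M, _, hM⟩ := exists_norm_le_of_periodic_snd hdb (fderiv_periodic_snd hbper) hhc
  refine (hasDerivAt_integral_of_dominated_loc_of_deriv_le (s := Set.univ)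
    (bound := fun I => M * ‖((0 : Fin d → ℝ), y)‖ * ‖h I‖)
    (F := fun (s : ℝ) I => b (I, z I + s • y) * h I)
    (F' := fun s I => fderiv ℝ b (I, z I + s • y) (0, y) * h I) Filter.univ_mem ?_ ?_ ?_ ?_ ?_ ?_).2
  · exact Filter.Eventually.of_forall fun s => Continuous.aestronglyMeasurable (by fun_prop)
  · exact Continuous.integrable_of_hasCompactSupport (by fun_prop) hhc.mul_left
  · exact Continuous.aestronglyMeasurable (by fun_prop)
  · refine ae_of_all _ fun I s _ => ?_
    rw [norm_mul]
    by_cases hI : I ∈ tsupport h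
    · exact mul_le_mul_of_nonneg_right (ContinuousLinearMap.le_of_opNorm_le _ (hM I hI _) _)
        (norm_nonneg _)
    · simp [image_eq_zero_of_notMem_tsupport hI]
  · exact (hh.integrable_of_hasCompactSupport hhc).norm.const_mul _
  · refine ae_of_all _ fun I s _ => HasDerivAt.mul_const ?_ (h I)
    have h1 : HasDerivAt (fun s : ℝ => (I, z I + s • y)) ((0 : Fin d → ℝ), y) s := by
      refine (hasDerivAt_const s I).prodMk ?_
      simpa using ((hasDerivAt_id s).smul_const y).const_add (z I)
    exact ((hb.differentiable (by simp)) _).hasFDerivAt.comp_hasDerivAt s h1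

/-- For a family of invariant tori with non-degenerate frequency map `ω`,
transported observables integrated against a density transversal to the foliation converge,
at rate `1/t`, to the torus averages of the observable weighted by the density. -/
theorem integrable_transversal_equidistribution
    (d : ℕ) (hd : 1 ≤ d)
    (b : (Fin d → ℝ) × (Fin d → ℝ) → ℂ) (hb : ContDiff ℝ (⊤ : ℕ∞) b)
    (hbper : ∀ (I x : Fin d → ℝ) (m : Fin d → ℤ), b (I, x + fun i => (m i : ℝ)) = b (I, x))
    (h : (Fin d → ℝ) → ℂ) (hh : ContDiff ℝ (⊤ : ℕ∞) h) (hhc : HasCompactSupport h)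
    (g : (Fin d → ℝ) → (Fin d → ℝ)) (hg : ContDiff ℝ (⊤ : ℕ∞) g)
    (ω : (Fin d → ℝ) → (Fin d → ℝ)) (hω : ContDiff ℝ (⊤ : ℕ∞) ω)
    (hnondeg : ∀ I ∈ tsupport h, Function.Bijective (fderiv ℝ ω I)) :
    ∃ C : ℝ, 0 < C ∧
      ∀ t : ℝ,
        ‖(∫ I : Fin d → ℝ, b (I, g I + t • ω I) * h I)
            - ∫ I : Fin d → ℝ, (∫ x in Set.Icc (0 : Fin d → ℝ) 1, b (I, x)) * h I‖
          ≤ C / (1 + |t|) := by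
  have hhc' := hh.continuous
  have hbc := hb.continuous
  have hdb : Continuous (fderiv ℝ b) := hb.continuous_fderiv (by simp)
  choose c hc using fun y =>
    exists_norm_mul_integral_fderiv_snd_le hb hbper hh hhc hg hω hnondeg y
  obtain ⟨M, hM0, hM⟩ := exists_norm_le_of_periodic_snd hbc hbper hhc
  have hhint : Integrable h := hhc'.integrable_of_hasCompactSupport hhc
  let C₁ : ℝ := ∑ k, c (Pi.single k 1)
  let C₀ : ℝ := 2 * ∫ I, M * ‖h I‖
  have hcube : ∀ y ∈ Set.Icc (0 : Fin d → ℝ) 1, ∀ t : ℝ,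
      (1 + |t|) * ‖(∫ I, b (I, g I + t • ω I + y) * h I) - ∫ I, b (I, g I + t • ω I) * h I‖
        ≤ C₀ + C₁ := by
    intro y hy t
    have hz : Continuous fun I => g I + t • ω I := by
      have := hg.continuous
      have := hω.continuous
      fun_prop
    have hbound : ∀ w : Fin d → ℝ, ‖∫ I, b (I, g I + t • ω I + w) * h I‖ ≤ ∫ I, M * ‖h I‖ := by
      intro w
      refine norm_integral_le_of_norm_le (hhint.norm.const_mul M) (ae_of_all _ fun I => ?_)
      rw [norm_mul]
      by_cases hI : I ∈ tsupport h
      · exact mul_le_mul_of_nonneg_right (hM I hI _) (norm_nonneg _)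
      · simp [image_eq_zero_of_notMem_tsupport hI]
    have hderiv : ∀ w : Fin d → ℝ,
        ‖(t : ℂ) * ∫ I, fderiv ℝ b (I, g I + t • ω I + w) (0, y) * h I‖ ≤ C₁ := by
      intro w
      have hsum : ∀ I, fderiv ℝ b (I, g I + t • ω I + w) (0, y) * h I
          = ∑ k, (y k : ℂ) * (fderiv ℝ b (I, g I + t • ω I + w) (0, Pi.single k 1) * h I) := by
        intro I
        have hy' : ((0 : Fin d → ℝ), y) = ∑ k, y k • ((0 : Fin d → ℝ), Pi.single k (1 : ℝ)) := by
          ext i <;> simp [Prod.fst_sum, Prod.snd_sum, Finset.sum_apply, Pi.single_apply]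
        rw [hy', map_sum, Finset.sum_mul]
        refine Finset.sum_congr rfl fun k _ => ?_
        rw [map_smul, Complex.real_smul, mul_assoc]
      simp_rw [hsum]
      have hcont : ∀ v, Continuous fun I => fderiv ℝ b (I, g I + t • ω I + w) v * h I := by
        fun_prop
      have hsumint : ∀ k, Integrable fun I =>
          (y k : ℂ) * (fderiv ℝ b (I, g I + t • ω I + w) (0, Pi.single k 1) * h I) := fun k =>
        ((hcont _).integrable_of_hasCompactSupport hhc.mul_left).const_mul _
      rw [integral_finsetSum _ fun k _ => hsumint k, Finset.mul_sum]
      refine (norm_sum_le _ _).trans (Finset.sum_le_sum fun k _ => ?_)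
      rw [integral_const_mul, mul_left_comm, norm_mul]
      have h1 : ‖(y k : ℂ)‖ ≤ 1 := by
        rw [Complex.norm_real, Real.norm_of_nonneg (hy.1 k)]
        exact hy.2 k
      exact (mul_le_of_le_one_left (norm_nonneg _) h1).trans (hc _ t w)
    have h0 : ‖(∫ I, b (I, g I + t • ω I + y) * h I) - ∫ I, b (I, g I + t • ω I) * h I‖ ≤ C₀ := by
      have h1 := hbound y
      have h2 := hbound 0
      simp only [add_zero] at h2
      refine (norm_sub_le _ _).trans ?_
      linarith [show C₀ = 2 * ∫ I, M * ‖h I‖ from rfl]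
    have h1 : |t| * ‖(∫ I, b (I, g I + t • ω I + y) * h I) - ∫ I, b (I, g I + t • ω I) * h I‖
        ≤ C₁ := by
      have := norm_image_sub_le_of_norm_deriv_le_segment_01'
        (f := fun s : ℝ => (t : ℂ) * ∫ I, b (I, g I + t • ω I + s • y) * h I)
        (fun s _ => ((hasDerivAt_integral_transport hb hbper hhc' hhc hz y s).const_mul
          (t : ℂ)).hasDerivWithinAt) (fun s _ => hderiv (s • y))
      simpa [← mul_sub] using this
    linarith
  have hC₀ : 0 ≤ C₀ := mul_nonneg zero_le_two (integral_nonneg fun I => by positivity)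
  have hC : 0 ≤ C₀ + C₁ := le_trans (by positivity) (hcube 0 ⟨le_rfl, zero_le_one⟩ 0)
  refine ⟨C₀ + C₁ + 1, by linarith, fun t => ?_⟩
  have hz : Continuous fun I => g I + t • ω I := by
    have := hg.continuous
    have := hω.continuous
    fun_prop
  obtain ⟨hint, havg⟩ := setIntegral_integral_transport_eq hbc hbper hhc' hhc hz
  have hvol : (volume : Measure (Fin d → ℝ)).real (Set.Icc 0 1) = 1 := by
    simp [Measure.real, Real.volume_Icc_pi]
  have hfin : (volume : Measure (Fin d → ℝ)) (Set.Icc 0 1) < ⊤ := isCompact_Icc.measure_lt_top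
  have hconst : ∫ _ in Set.Icc (0 : Fin d → ℝ) 1, (∫ I, b (I, g I + t • ω I) * h I)
      = ∫ I, b (I, g I + t • ω I) * h I := by
    rw [setIntegral_const, hvol, one_smul]
  rw [← havg, norm_sub_rev, ← hconst, ← integral_sub hint (integrableOn_const hfin.ne)]
  have hpos : 0 < 1 + |t| := by positivity
  refine (norm_setIntegral_le_of_norm_le_const hfin (C := (C₀ + C₁ + 1) / (1 + |t|))
    fun y hy => ?_).trans_eq (by rw [hvol, mul_one])
  rw [le_div_iff₀ hpos, mul_comm]
  linarith [hcube y hy t]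
end

section
/- Let (X, d) be a metric space, μ a probability measure on X, and Φ : ℝ × X → X a flow (written Φ^t) with each map Φ^t measurable. Fix α ∈ (0,1] and assume exponential mixing for Hölder observables: there exist C₀, γ₀ > 0 such that for all bounded α-Hölder functions a, b : X → ℂ and all t ≥ 0, |∫_X (a ∘ Φ^t) · b dμ − (∫_X a dμ)(∫_X b dμ)| ≤ C₀ ‖a‖_{C^α} ‖b‖_{C^α} e^{−γ₀ t}. Let ν be a finite nonnegative measure on X and suppose there exist a measurable map π : X → X, a bounded nonnegative α-Hölder function ρ : X → ℝ, and constants C₁, γ₁ > 0 such that (i) the pushforward of the measure ρ·μ under π equals ν, and (ii) d(Φ^t(z), Φ^t(π(z))) ≤ C₁ e^{−γ₁ t} for all t ≥ 0 and all z with ρ(z) ≠ 0. Then there exists C > 0 such that for every bounded α-Hölder function a : X → ℂ and all t ≥ 0, |∫_X a ∘ Φ^t dν − ν(X) ∫_X a dμ| ≤ C ‖a‖_{C^α} e^{−γ t}, where γ = min(γ₀, α γ₁). (This is the abstract core of the paper's Theorem 3.3(i): a measure that is shadowed, exponentially fast along the flow, by an absolutely continuous measure with Hölder density becomes equidistributed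 with respect to μ at an exponential rate.) -/
open MeasureTheory

variable {X : Type*} [MetricSpace X]

/-- `f` is bounded and `α`-Hölder continuous. -/
def IsBoundedHolder (α : ℝ) (f : X → ℂ) : Prop :=
  (∃ M : ℝ, ∀ x : X, ‖f x‖ ≤ M) ∧
    ∃ L : ℝ, ∀ x y : X, ‖f x - f y‖ ≤ L * dist x y ^ α

/-- The Hölder seminorm `|f|_α = sup_{x ≠ y} ‖f x - f y‖ / d(x,y)^α`. -/
noncomputable def holderSeminorm (α : ℝ) (f : X → ℂ) : ℝ :=
  ⨆ p : X × X, ‖f p.1 - f p.2‖ / dist p.1 p.2 ^ α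

/-- The Hölder norm `‖f‖_{C^α} = sup ‖f‖ + |f|_α`. -/
noncomputable def holderNorm (α : ℝ) (f : X → ℂ) : ℝ :=
  (⨆ x : X, ‖f x‖) + holderSeminorm α f

theorem holderSeminorm_nonneg (α : ℝ) (f : X → ℂ) : 0 ≤ holderSeminorm α f :=
  Real.iSup_nonneg fun _ => by positivity

theorem holderSeminorm_le_holderNorm (α : ℝ) (f : X → ℂ) :
    holderSeminorm α f ≤ holderNorm α f :=
  le_add_of_nonneg_left (Real.iSup_nonneg fun _ => norm_nonneg _)

theorem holderNorm_nonneg (α : ℝ) (f : X → ℂ) : 0 ≤ holderNorm α f :=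
  (holderSeminorm_nonneg α f).trans (holderSeminorm_le_holderNorm α f)

theorem IsBoundedHolder.norm_sub_le {α : ℝ} {f : X → ℂ} (hf : IsBoundedHolder α f) (x y : X) :
    ‖f x - f y‖ ≤ holderSeminorm α f * dist x y ^ α := by
  obtain ⟨L, hL⟩ := hf.2
  rcases eq_or_ne x y with rfl | hxy
  · simpa using mul_nonneg (holderSeminorm_nonneg α f) (Real.rpow_nonneg (dist_nonneg (x := x) (y := x)) α)
  · have hd : 0 < dist x y ^ α := Real.rpow_pos_of_pos (dist_pos.2 hxy) α
    have hbdd : BddAbove (Set.range fun p : X × X => ‖f p.1 - f p.2‖ / dist p.1 p.2 ^ α) := by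
      refine ⟨max L 0, ?_⟩
      rintro _ ⟨p, rfl⟩
      have hp : 0 ≤ dist p.1 p.2 ^ α := Real.rpow_nonneg dist_nonneg α
      exact div_le_of_le_mul₀ hp (le_max_right _ _)
        ((hL p.1 p.2).trans (mul_le_mul_of_nonneg_right (le_max_left _ _) hp))
    exact (div_le_iff₀ hd).1 (le_ciSup hbdd (x, y))

theorem IsBoundedHolder.continuous {α : ℝ} (hα : 0 < α) {f : X → ℂ} (hf : IsBoundedHolder α f) :
    Continuous f := by
  refine continuous_iff_continuousAt.2 fun x => tendsto_iff_norm_sub_tendsto_zero.2 ?_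
  have hd : Filter.Tendsto (fun y : X => holderSeminorm α f * dist y x ^ α) (nhds x) (nhds 0) := by
    have hdist : Continuous fun y => dist y x := by fun_prop
    have hc : Continuous fun y => holderSeminorm α f * dist y x ^ α :=
      continuous_const.mul (hdist.rpow_const fun _ => .inr hα.le)
    simpa [Real.zero_rpow hα.ne'] using hc.tendsto x
  exact squeeze_zero (fun _ => norm_nonneg _) (fun y => hf.norm_sub_le y x) hd

/-- Abstract equidistribution of shadowed measures: if the flow is
exponentially mixing for Hölder observables with respect to `μ`, and `ν` is a finite measure
which is shadowed, exponentially fast along the flow, by a measure with bounded Hölder density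
with respect to `μ`, then the transported integrals against `ν` converge at exponential rate
`γ = min(γ₀, αγ₁)` to `ν(X) ∫ a dμ`. -/
theorem shadowed_measure_equidistribution
    {X : Type*} [MetricSpace X] [MeasurableSpace X] [BorelSpace X]
    (μ : Measure X) [IsProbabilityMeasure μ]
    (Φ : ℝ → X → X) (hΦ0 : Φ 0 = id) (hΦgrp : ∀ s t : ℝ, Φ (s + t) = Φ s ∘ Φ t)
    (hΦmeas : ∀ t : ℝ, Measurable (Φ t))
    (α : ℝ) (hα : α ∈ Set.Ioc (0:ℝ) 1)
    (C₀ γ₀ : ℝ) (hC₀ : 0 < C₀) (hγ₀ : 0 < γ₀)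
    (hmix : ∀ (a b : X → ℂ), IsBoundedHolder α a → IsBoundedHolder α b →
      ∀ t : ℝ, 0 ≤ t →
        ‖(∫ x, (a (Φ t x)) * b x ∂μ) - (∫ x, a x ∂μ) * (∫ x, b x ∂μ)‖
          ≤ C₀ * holderNorm α a * holderNorm α b * Real.exp (-γ₀ * t))
    (ν : Measure X) [IsFiniteMeasure ν]
    (π : X → X) (hπ : Measurable π)
    (ρ : X → ℝ) (hρmeas : Measurable ρ) (hρ0 : ∀ x, 0 ≤ ρ x)
    (hρbdd : ∃ M : ℝ, ∀ x, ρ x ≤ M)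
    (hρhol : ∃ L : ℝ, ∀ x y : X, |ρ x - ρ y| ≤ L * dist x y ^ α)
    (hpush : Measure.map π (μ.withDensity (fun x => ENNReal.ofReal (ρ x))) = ν)
    (C₁ γ₁ : ℝ) (hC₁ : 0 < C₁) (hγ₁ : 0 < γ₁)
    (hshadow : ∀ t : ℝ, 0 ≤ t → ∀ z : X, ρ z ≠ 0 →
      dist (Φ t z) (Φ t (π z)) ≤ C₁ * Real.exp (-γ₁ * t)) :
    ∃ C : ℝ, 0 < C ∧
      ∀ (a : X → ℂ), IsBoundedHolder α a →
        ∀ t : ℝ, 0 ≤ t →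
          ‖(∫ x, a (Φ t x) ∂ν) - ((ν Set.univ).toReal : ℂ) * ∫ x, a x ∂μ‖
            ≤ C * holderNorm α a * Real.exp (-(min γ₀ (α * γ₁)) * t) := by
  obtain ⟨hα0, -⟩ := hα
  set m : Measure X := μ.withDensity fun x => ENNReal.ofReal (ρ x) with hm
  have hmν : m Set.univ = ν Set.univ := by
    rw [← hpush, Measure.map_apply hπ MeasurableSet.univ, Set.preimage_univ]
  have : IsFiniteMeasure m := ⟨hmν ▸ measure_lt_top ν _⟩
  have hreal : m.real Set.univ = (ν Set.univ).toReal := by rw [measureReal_def, hmν]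
  have hintegral (f : X → ℂ) : ∫ x, f x ∂m = ∫ x, f x * (ρ x : ℂ) ∂μ := by
    rw [hm, integral_withDensity_eq_integral_toReal_smul hρmeas.ennreal_ofReal
      (Filter.Eventually.of_forall fun _ => ENNReal.ofReal_lt_top)]
    refine integral_congr_ae (Filter.Eventually.of_forall fun x => ?_)
    simp [ENNReal.toReal_ofReal (hρ0 x), mul_comm]
  have hρ : IsBoundedHolder α fun x => (ρ x : ℂ) := by
    obtain ⟨M, hM⟩ := hρbdd
    obtain ⟨L, hL⟩ := hρhol
    refine ⟨⟨M, fun x => ?_⟩, L, fun x y => ?_⟩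
    · rw [Complex.norm_real, Real.norm_of_nonneg (hρ0 x)]
      exact hM x
    · rw [← Complex.ofReal_sub, Complex.norm_real]
      exact hL x y
  have hmass : ∫ x, (ρ x : ℂ) ∂μ = ((ν Set.univ).toReal : ℂ) := by
    simpa [hreal] using (hintegral fun _ => 1).symm
  have hsupp : ∀ᵐ z ∂m, ρ z ≠ 0 := by
    rw [hm, ae_withDensity_iff hρmeas.ennreal_ofReal]
    refine Filter.Eventually.of_forall fun z hz h0 => hz ?_
    simp [h0]
  set R := holderNorm α fun x => (ρ x : ℂ)
  have hR : 0 ≤ R := holderNorm_nonneg _ _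
  set V := (ν Set.univ).toReal
  have hV : 0 ≤ V := ENNReal.toReal_nonneg
  refine ⟨C₁ ^ α * V + C₀ * R + 1, by positivity, fun a ha t ht => ?_⟩
  have hN : 0 ≤ holderNorm α a := holderNorm_nonneg _ _
  have hmeas : Measurable fun x => a (Φ t x) := (ha.continuous hα0).measurable.comp (hΦmeas t)
  have hint {f : X → X} (hf : Measurable f) : Integrable (fun z => a (Φ t (f z))) m := by
    obtain ⟨M, hM⟩ := ha.1
    exact .of_bound (hmeas.comp hf).aestronglyMeasurable M
      (Filter.Eventually.of_forall fun z => hM _)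
  have hpull : ∫ x, a (Φ t x) ∂ν = ∫ z, a (Φ t (π z)) ∂m := by
    rw [← hpush, integral_map hπ.aemeasurable hmeas.aestronglyMeasurable]
  have hclose : ‖∫ z, a (Φ t (π z)) ∂m - ∫ z, a (Φ t z) ∂m‖
      ≤ holderNorm α a * (C₁ ^ α * Real.exp (-(α * γ₁) * t)) * V := by
    rw [← integral_sub (hint hπ) (hint (f := fun z => z) measurable_id), ← hreal]
    refine norm_integral_le_of_norm_le_const (hsupp.mono fun z hz => ?_)
    refine (ha.norm_sub_le _ _).trans ?_
    have hd : dist (Φ t (π z)) (Φ t z) ^ α ≤ C₁ ^ α * Real.exp (-(α * γ₁) * t) := by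
      rw [dist_comm]
      refine (Real.rpow_le_rpow dist_nonneg (hshadow t ht z hz) hα0.le).trans_eq ?_
      rw [Real.mul_rpow hC₁.le (Real.exp_pos _).le, ← Real.exp_mul]
      ring_nf
    exact mul_le_mul (holderSeminorm_le_holderNorm α a) hd (by positivity) hN
  have hmixρ := hmix a _ ha hρ t ht
  rw [hmass, ← hintegral fun x => a (Φ t x)] at hmixρ
  set E := Real.exp (-(min γ₀ (α * γ₁)) * t)
  have hE₀ : Real.exp (-γ₀ * t) ≤ E :=
    Real.exp_le_exp.2 (mul_le_mul_of_nonneg_right (neg_le_neg (min_le_left _ _)) ht)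
  have hE₁ : Real.exp (-(α * γ₁) * t) ≤ E :=
    Real.exp_le_exp.2 (mul_le_mul_of_nonneg_right (neg_le_neg (min_le_right _ _)) ht)
  have hE : 0 ≤ E := (Real.exp_pos _).le
  rw [hpull, mul_comm (V : ℂ)]
  calc ‖∫ z, a (Φ t (π z)) ∂m - (∫ x, a x ∂μ) * V‖
      ≤ ‖∫ z, a (Φ t (π z)) ∂m - ∫ z, a (Φ t z) ∂m‖
        + ‖∫ z, a (Φ t z) ∂m - (∫ x, a x ∂μ) * V‖ := norm_sub_le_norm_sub_add_norm_sub _ _ _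
    _ ≤ holderNorm α a * (C₁ ^ α * E) * V + C₀ * holderNorm α a * R * E := by
        refine add_le_add (hclose.trans ?_) (hmixρ.trans ?_) <;> gcongr
    _ ≤ (C₁ ^ α * V + C₀ * R + 1) * holderNorm α a * E := by
        linarith [mul_nonneg hN hE]
end

section
/- Let d ≥ 1, T > 0, γ > 0, α ∈ (0,1]. Let a : ℝ × ℝ^{d−1} → ℂ be bounded, α-Hölder, and T-periodic in its first argument. Let σ̂ : ℝ × ℝ^{d−1} → ℂ be smooth, T-periodic in its first argument, and supported in ℝ × B for some compact B ⊂ ℝ^{d−1}; set σ̄(r) := ∫_{ℝ^{d−1}} σ̂(r,x) dx. Let X : [0,∞) × ℝ × ℝ^{d−1} → ℝ^{d−1} be measurable with ‖X(t,r,x)‖ ≤ C₀ e^{−γ t} for some C₀ > 0, all t ≥ 0 and all (r,x) in the support of σ̂. Define a_k := (1/T)∫_0^T a(r,0) e^{−2πik r/T} dr and σ̃_k := ∫_0^T σ̄(r) e^{2πik r/T} dr for k ∈ ℤ. Then the family (a_k σ̃_k)_{k∈ℤ} is absolutely summable, and there exists C > 0 such that for all t ≥ 0, |∫_0^T ∫_{ℝ^{d−1}}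 a(r + t, X(t,r,x)) σ̂(r,x) dx dr − ∑_{k∈ℤ} a_k σ̃_k e^{2πik t/T}| ≤ C e^{−αγ t}. (This is the classical computation in Section 3 showing that when the Lagrangian manifold is the stable manifold of a periodic orbit of period T — so that the flow in adapted coordinates is Φ^t(r,x) = (r+t, X(t,r,x)) with exponential contraction in x — the transported correlation is, up to an exponentially small error, the almost periodic sum appearing in equation (1.14).) -/
open MeasureTheory Real

/-- The `k`-th Fourier coefficient `a_k = (1/T) ∫_0^T a(r,0) e^{-2πikr/T} dr` of the
observable restricted to the periodic orbit. -/
noncomputable def orbitFourierCoeff (d : ℕ) (T : ℝ) (a : ℝ × (Fin (d-1) → ℝ) → ℂ)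
    (k : ℤ) : ℂ :=
  (1 / (T : ℂ)) * ∫ r in (0:ℝ)..T,
    a (r, 0) * Complex.exp (-(2 * π * Complex.I) * (k : ℂ) * (r : ℂ) / (T : ℂ))

/-- The coefficient `σ̃_k = ∫_0^T σ̄(r) e^{2πikr/T} dr`, where
`σ̄(r) = ∫_{ℝ^{d-1}} σ̂(r,x) dx`. -/
noncomputable def densityFourierCoeff (d : ℕ) (T : ℝ) (σ : ℝ × (Fin (d-1) → ℝ) → ℂ)
    (k : ℤ) : ℂ :=
  ∫ r in (0:ℝ)..T,
    (∫ x : Fin (d-1) → ℝ, σ (r, x)) * Complex.exp ((2 * π * Complex.I) * (k : ℂ) * (r : ℂ) / (T : ℂ))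

/-- Parseval's identity for two continuous functions on the circle, in bilinear form. -/
theorem AddCircle.hasSum_integral_mul_fourier {T : ℝ} [Fact (0 < T)] (F G : C(AddCircle T, ℂ)) :
    HasSum (fun k : ℤ => (∫ x, G x * fourier k x ∂haarAddCircle) *
        ∫ x, F x * fourier (-k) x ∂haarAddCircle)
      (∫ x, F x * G x ∂haarAddCircle) := by
  have h := (fourierBasis (T := T)).hasSum_inner_mul_inner
    (ContinuousMap.toLp (E := ℂ) 2 haarAddCircle ℂ (star G))
    (ContinuousMap.toLp (E := ℂ) 2 haarAddCircle ℂ F)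
  simp only [coe_fourierBasis, ContinuousMap.inner_toLp, ContinuousMap.star_apply,
    RCLike.star_def, RCLike.conj_conj, ← fourier_neg] at h
  simpa only [mul_comm] using h

/-- The continuous function on the circle induced by a continuous periodic function. -/
def Function.Periodic.liftContinuousMap {T : ℝ} {f : ℝ → ℂ} (hf : Function.Periodic f T)
    (hfc : Continuous f) : C(AddCircle T, ℂ) where
  toFun := hf.lift
  continuous_toFun := hfc.quotient_liftOn' _

theorem Function.Periodic.liftContinuousMap_coe {T : ℝ} {f : ℝ → ℂ} (hf : Function.Periodic f T)
    (hfc : Continuous f) (r : ℝ) : hf.liftContinuousMap hfc (r : AddCircle T) = f r :=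
  rfl

theorem AddCircle.integral_haarAddCircle_eq_intervalIntegral {T : ℝ} [hT : Fact (0 < T)]
    (f : AddCircle T → ℂ) :
    ∫ x, f x ∂haarAddCircle = (1 / (T : ℂ)) * ∫ r in (0:ℝ)..T, f (r : AddCircle T) := by
  have h := AddCircle.intervalIntegral_preimage T 0 f
  rw [zero_add] at h
  rw [AddCircle.integral_haarAddCircle, h, Complex.real_smul, Complex.ofReal_inv, one_div]

/-- Parseval's identity for two continuous periodic functions on the line. -/
theorem Function.Periodic.hasSum_fourier_mul_fourier {T : ℝ} (hT : 0 < T) {f g : ℝ → ℂ}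
    (hf : Function.Periodic f T) (hfc : Continuous f)
    (hg : Function.Periodic g T) (hgc : Continuous g) :
    HasSum (fun k : ℤ =>
        ((1 / (T : ℂ)) * ∫ r in (0:ℝ)..T,
          f r * Complex.exp (-(2 * π * Complex.I) * (k : ℂ) * (r : ℂ) / (T : ℂ))) *
        ∫ r in (0:ℝ)..T,
          g r * Complex.exp ((2 * π * Complex.I) * (k : ℂ) * (r : ℂ) / (T : ℂ)))
      (∫ r in (0:ℝ)..T, f r * g r) := by
  have : Fact (0 < T) := ⟨hT⟩
  have hT0 : (T : ℂ) ≠ 0 := by exact_mod_cast hT.ne'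
  have h := (AddCircle.hasSum_integral_mul_fourier (hf.liftContinuousMap hfc)
    (hg.liftContinuousMap hgc)).mul_left (T : ℂ)
  simp only [AddCircle.integral_haarAddCircle_eq_intervalIntegral, fourier_coe_apply,
    Function.Periodic.liftContinuousMap_coe] at h
  rw [← mul_assoc, mul_one_div_cancel hT0, one_mul] at h
  refine h.congr_fun fun k => ?_
  simp only [Int.cast_neg, mul_neg, neg_mul]
  field_simp

/-- Translating a periodic function by `t` multiplies its `k`-th Fourier integral by
`exp (2πikt/T)`. -/
theorem Function.Periodic.intervalIntegral_comp_add_mul_exp {T : ℝ} (hT : 0 < T) {f : ℝ → ℂ}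
    (hf : Function.Periodic f T) (k : ℤ) (t : ℝ) :
    ∫ r in (0:ℝ)..T,
        f (r + t) * Complex.exp (-(2 * π * Complex.I) * (k : ℂ) * (r : ℂ) / (T : ℂ)) =
      (∫ r in (0:ℝ)..T,
        f r * Complex.exp (-(2 * π * Complex.I) * (k : ℂ) * (r : ℂ) / (T : ℂ))) *
        Complex.exp ((2 * π * Complex.I) * (k : ℂ) * (t : ℂ) / (T : ℂ)) := by
  have hT0 : (T : ℂ) ≠ 0 := by exact_mod_cast hT.ne'
  have hper : Function.Periodic (fun r : ℝ =>
      f r * Complex.exp (-(2 * π * Complex.I) * (k : ℂ) * (r : ℂ) / (T : ℂ))) T := by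
    intro r
    simp only [hf r]
    congr 1
    refine Complex.exp_eq_exp_iff_exists_int.mpr ⟨-k, ?_⟩
    push_cast
    field_simp
    ring
  have hshift := hper.intervalIntegral_add_eq t 0
  rw [zero_add] at hshift
  rw [← hshift, ← intervalIntegral.integral_mul_const, add_comm t T]
  conv_rhs => rw [← zero_add t, ← add_assoc, add_zero,
    ← intervalIntegral.integral_comp_add_right]
  congr 1
  ext r
  rw [mul_assoc (f _), ← Complex.exp_add]
  congr 2
  push_cast
  field_simp
  ring

theorem continuous_of_norm_sub_le_mul_dist_rpow {E F : Type*} [PseudoMetricSpace E]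
    [SeminormedAddCommGroup F] {f : E → F} {L α : ℝ} (hα : 0 < α)
    (hf : ∀ p q, ‖f p - f q‖ ≤ L * dist p q ^ α) : Continuous f := by
  refine continuous_iff_continuousAt.mpr fun p => ?_
  rw [ContinuousAt, tendsto_iff_norm_sub_tendsto_zero]
  have hlim : Filter.Tendsto (fun q => L * dist q p ^ α) (nhds p) (nhds 0) := by
    have hc : Continuous fun q => L * dist q p ^ α :=
      continuous_const.mul ((continuous_id.dist continuous_const).rpow_const
        fun _ => Or.inr hα.le)
    simpa [hα.ne'] using hc.tendsto p
  exact squeeze_zero (fun _ => norm_nonneg _) (fun q => hf q p) hlim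

section FiberwiseCompactSupport

variable {E : Type*} [NormedAddCommGroup E] [MeasureSpace E] [OpensMeasurableSpace E]
  [IsLocallyFiniteMeasure (volume : Measure E)]
  {σ : ℝ × E → ℂ} {B : Set E}

theorem continuous_integral_snd_of_support_subset (hσ : Continuous σ) (hB : IsCompact B)
    (hσB : Function.support σ ⊆ Set.univ ×ˢ B) : Continuous fun r => ∫ x, σ (r, x) := by
  have h := continuous_parametric_integral_of_continuous (μ := (volume : Measure E))
    (f := fun r x => σ (r, x)) hσ hB
  convert h using 2 with r
  refine (setIntegral_eq_integral_of_forall_compl_eq_zero fun x hx => ?_).symm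
  by_contra hne
  exact hx (hσB hne).2

theorem integrable_prod_of_support_subset [SecondCountableTopology E] [SFinite (volume : Measure E)]
    (hσ : Continuous σ) (hB : IsCompact B)
    (hσB : Function.support σ ⊆ Set.univ ×ˢ B) (T : ℝ) :
    Integrable σ ((volume.restrict (Set.Ioc 0 T)).prod volume) := by
  have h : IntegrableOn σ (Set.Icc 0 T ×ˢ B) (volume.prod volume) :=
    hσ.continuousOn.integrableOn_compact (isCompact_Icc.prod hB)
  have h' : IntegrableOn σ (Set.Icc 0 T ×ˢ Set.univ) (volume.prod volume) := by
    refine h.of_forall_sdiff_eq_zero (measurableSet_Icc.prod MeasurableSet.univ) ?_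
    rintro ⟨r, x⟩ ⟨hr, hx⟩
    by_contra hne
    exact hx ⟨hr.1, (hσB hne).2⟩
  have h'' := h'.mono_set (Set.prod_mono_left Set.Ioc_subset_Icc_self)
  rwa [IntegrableOn, ← Measure.prod_restrict, Measure.restrict_univ] at h''

end FiberwiseCompactSupport

/-- If in adapted coordinates the flow is `Φ^t(r,x) = (r+t, X(t,r,x))` with
exponential contraction in `x` (the Lagrangian manifold being the stable manifold of a
periodic orbit of period `T`), then the transported correlation is, up to an exponentially
small error, an almost periodic sum given by Fourier coefficients. -/
theorem stable_manifold_periodic_orbit_correlation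
    (d : ℕ) (hd : 1 ≤ d) (T : ℝ) (hT : 0 < T) (γ : ℝ) (hγ : 0 < γ)
    (α : ℝ) (hα : α ∈ Set.Ioc (0:ℝ) 1)
    (a : ℝ × (Fin (d-1) → ℝ) → ℂ)
    (habdd : ∃ M : ℝ, ∀ p, ‖a p‖ ≤ M)
    (hahol : ∃ L : ℝ, ∀ p q, ‖a p - a q‖ ≤ L * dist p q ^ α)
    (haper : ∀ (r : ℝ) (x : Fin (d-1) → ℝ), a (r + T, x) = a (r, x))
    (σ : ℝ × (Fin (d-1) → ℝ) → ℂ) (hσ : ContDiff ℝ (⊤ : ℕ∞) σ)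
    (hσper : ∀ (r : ℝ) (x : Fin (d-1) → ℝ), σ (r + T, x) = σ (r, x))
    (B : Set (Fin (d-1) → ℝ)) (hB : IsCompact B)
    (hσsupp : tsupport σ ⊆ Set.univ ×ˢ B)
    (X : ℝ → ℝ → (Fin (d-1) → ℝ) → (Fin (d-1) → ℝ))
    (hXmeas : Measurable (fun p : ℝ × ℝ × (Fin (d-1) → ℝ) => X p.1 p.2.1 p.2.2))
    (C₀ : ℝ) (hC₀ : 0 < C₀)
    (hX : ∀ t : ℝ, 0 ≤ t → ∀ (r : ℝ) (x : Fin (d-1) → ℝ), (r, x) ∈ tsupport σ →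
      ‖X t r x‖ ≤ C₀ * Real.exp (-γ * t)) :
    Summable (fun k : ℤ => ‖orbitFourierCoeff d T a k * densityFourierCoeff d T σ k‖) ∧
    ∃ C : ℝ, 0 < C ∧
      ∀ t : ℝ, 0 ≤ t →
        ‖(∫ r in (0:ℝ)..T, ∫ x : Fin (d-1) → ℝ, a (r + t, X t r x) * σ (r, x))
            - ∑' k : ℤ, orbitFourierCoeff d T a k * densityFourierCoeff d T σ k *
                Complex.exp ((2 * π * Complex.I) * (k : ℂ) * (t : ℂ) / (T : ℂ))‖
          ≤ C * Real.exp (-(α * γ) * t) := by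
  obtain ⟨hα0, -⟩ := hα
  obtain ⟨M, hM⟩ := habdd
  obtain ⟨L, hL⟩ := hahol
  have ha : Continuous a := continuous_of_norm_sub_le_mul_dist_rpow hα0 hL
  have hsupp : Function.support σ ⊆ Set.univ ×ˢ B := (subset_tsupport σ).trans hσsupp
  have hf : Function.Periodic (fun r => a (r, 0)) T := fun r => haper r 0
  have hfc : Continuous fun r => a (r, 0) := by fun_prop
  have hg : Function.Periodic (fun r => ∫ x, σ (r, x)) T := fun r => by simp only [hσper]
  have hgc := continuous_integral_snd_of_support_subset hσ.continuous hB hsupp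
  refine ⟨(hf.hasSum_fourier_mul_fourier hT hfc hg hgc).summable.norm, ?_⟩
  set ν : Measure (ℝ × (Fin (d-1) → ℝ)) := (volume.restrict (Set.Ioc 0 T)).prod volume with hν
  have hσint : Integrable σ ν :=
    integrable_prod_of_support_subset hσ.continuous hB hsupp T
  have hsum (t : ℝ) : ∑' k : ℤ, orbitFourierCoeff d T a k * densityFourierCoeff d T σ k *
      Complex.exp ((2 * π * Complex.I) * (k : ℂ) * (t : ℂ) / (T : ℂ)) =
      ∫ r in (0:ℝ)..T, ∫ x, a (r + t, 0) * σ (r, x) := by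
    have hft : Function.Periodic (fun r => a (r + t, 0)) T := fun r => by
      simpa only [add_right_comm] using haper (r + t) 0
    have h := (hft.hasSum_fourier_mul_fourier hT (by fun_prop) hg hgc).tsum_eq
    simp only [integral_const_mul]
    rw [← h]
    refine tsum_congr fun k => ?_
    rw [hf.intervalIntegral_comp_add_mul_exp hT, orbitFourierCoeff, densityFourierCoeff]
    ring
  have hint {Y : ℝ × (Fin (d-1) → ℝ) → (Fin (d-1) → ℝ)} (hY : Measurable Y) (t : ℝ) :
      Integrable (fun p => a (p.1 + t, Y p) * σ p) ν :=
    hσint.bdd_mul (ha.measurable.comp (by fun_prop)).aestronglyMeasurable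
      (Filter.Eventually.of_forall fun p => hM _)
  have hiter {u : ℝ × (Fin (d-1) → ℝ) → ℂ} (hu : Integrable u ν) :
      ∫ r in (0:ℝ)..T, ∫ x, u (r, x) = ∫ p, u p ∂ν := by
    rw [intervalIntegral.integral_of_le hT.le, integral_prod u hu]
  refine ⟨|L| * C₀ ^ α * (∫ p, ‖σ p‖ ∂ν) + 1, by positivity, fun t ht => ?_⟩
  have hXt : Measurable fun p : ℝ × (Fin (d-1) → ℝ) => X t p.1 p.2 :=
    hXmeas.comp (measurable_const.prodMk measurable_id)
  rw [hsum, hiter (hint hXt t), hiter (hint (measurable_const (a := 0)) t),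
    ← integral_sub (hint hXt t) (hint measurable_const t)]
  have hbound (p : ℝ × (Fin (d-1) → ℝ)) :
      ‖a (p.1 + t, X t p.1 p.2) * σ p - a (p.1 + t, 0) * σ p‖ ≤
        |L| * C₀ ^ α * Real.exp (-(α * γ) * t) * ‖σ p‖ := by
    rw [← sub_mul, norm_mul]
    by_cases hp : p ∈ tsupport σ
    · gcongr
      have hd : dist (p.1 + t, X t p.1 p.2) (p.1 + t, 0) ≤ C₀ * Real.exp (-γ * t) := by
        simpa [Prod.dist_eq] using hX t ht p.1 p.2 hp
      calc _ ≤ L * dist (p.1 + t, X t p.1 p.2) (p.1 + t, 0) ^ α := hL _ _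
        _ ≤ |L| * (C₀ * Real.exp (-γ * t)) ^ α := by
          gcongr
          exact le_abs_self L
        _ = |L| * C₀ ^ α * Real.exp (-(α * γ) * t) := by
          rw [Real.mul_rpow hC₀.le (Real.exp_nonneg _), ← Real.exp_mul, mul_assoc]
          ring_nf
    · simp [image_eq_zero_of_notMem_tsupport hp]
  calc _ ≤ ∫ p, |L| * C₀ ^ α * Real.exp (-(α * γ) * t) * ‖σ p‖ ∂ν :=
        norm_integral_le_of_norm_le (hσint.norm.const_mul _) (Filter.Eventually.of_forall hbound)
    _ = |L| * C₀ ^ α * (∫ p, ‖σ p‖ ∂ν) * Real.exp (-(α * γ) * t) := by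
      rw [integral_const_mul]
      ring
    _ ≤ _ := by
      gcongr
      exact le_add_of_nonneg_right zero_le_one
end

section
/- Let X : ℝ^n → ℝ^n be a smooth compactly supported vector field and let Φ : ℝ × ℝ^n → ℝ^n be its flow, i.e. Φ^0 = id and (d/dt)Φ^t(z) = X(Φ^t(z)). Then for every integer k ≥ 0 there exist constants C > 0 and Γ > 0 such that for every a ∈ C_c^∞(ℝ^n; ℂ) and every t ∈ ℝ, ∑_{|β| ≤ k} sup_{ℝ^n} |∂^β (a ∘ Φ^t)| ≤ C e^{Γ|t|} ∑_{|β| ≤ k} sup_{ℝ^n} |∂^β a|. (This exponential growth bound on the derivatives of classically transported observables is the estimate, quoted as Lemma 2.4 of Bouzouina–Robert, used in the proof of Proposition 2.1 to control the error term C ∑_{|β|≤k} sup|∂^β(a∘Φ^t)| ħ coming from Lemma 2.2.) -/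
open MeasureTheory Real

open Filter Topology ContDiff

section

variable {E F : Type} [NormedAddCommGroup E] [NormedSpace ℝ E]
  [NormedAddCommGroup F] [NormedSpace ℝ F]

/-- Iterates of a `C^∞` self-map are `C^∞`. -/
theorem contDiff_iterate {f : E → E} (hf : ContDiff ℝ ∞ f) (m : ℕ) : ContDiff ℝ ∞ f^[m] := by
  induction m with
  | zero => exact contDiff_id
  | succ m ih => exact ih.comp hf

/-- A uniform bound on the derivatives of a vector field `X` controls the growth of derivatives
under composition with one Euler step `z ↦ z + h • X z`. -/
theorem exists_norm_iteratedFDeriv_comp_euler_step_le {X : E → E} (hX : ContDiff ℝ ∞ X)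
    (hbdd : ∀ j, ∃ B, ∀ z, ‖iteratedFDeriv ℝ j X z‖ ≤ B) (k : ℕ) :
    ∃ K, 0 ≤ K ∧ ∀ (F : Type) [NormedAddCommGroup F] [NormedSpace ℝ F] (a : E → F) (M h : ℝ),
      ContDiff ℝ ∞ a → (∀ j ≤ k, ∀ z, ‖iteratedFDeriv ℝ j a z‖ ≤ M) → |h| ≤ 1 →
      ∀ j ≤ k, ∀ z, ‖iteratedFDeriv ℝ j (fun w => a (w + h • X w)) z‖ ≤ (1 + K * |h|) * M := by
  induction k with
  | zero =>
    refine ⟨0, le_rfl, fun F _ _ a M h ha hM hh j hj z => ?_⟩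
    obtain rfl : j = 0 := by omega
    have := hM 0 le_rfl (z + h • X z)
    simpa using this
  | succ k ih =>
    obtain ⟨K, hK, ih⟩ := ih
    choose B hB using hbdd
    have hB0 (j) : 0 ≤ B j := (norm_nonneg _).trans (hB j 0)
    set S := ∑ i ∈ Finset.range (k + 2), B i
    have hBS {i : ℕ} (hi : i ≤ k + 1) : B i ≤ S :=
      Finset.single_le_sum (fun i _ => hB0 i) (by simp; omega)
    have hS0 : 0 ≤ S := Finset.sum_nonneg fun i _ => hB0 i
    refine ⟨K + 2 ^ k * (1 + K) * S, by positivity, fun F _ _ a M h ha hM hh j hj z => ?_⟩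
    have hM0 : 0 ≤ M := (norm_nonneg _).trans (hM 0 (by omega) z)
    have hda : ContDiff ℝ ∞ (fderiv ℝ a) := ha.fderiv_right (by simp)
    have hdX : ContDiff ℝ ∞ (fderiv ℝ X) := hX.fderiv_right (by simp)
    have hstep : ContDiff ℝ ∞ fun w => w + h • X w := contDiff_id.add (hX.const_smul h)
    cases j with
    | zero =>
      have := hM 0 (by omega) (z + h • X z)
      simp only [norm_iteratedFDeriv_zero] at this ⊢
      exact this.trans (le_mul_of_one_le_left hM0 (le_add_of_nonneg_right (by positivity)))
    | succ j =>
      have hjk : j ≤ k := by omega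
      set b : E → E →L[ℝ] F := fun w => fderiv ℝ a (w + h • X w) with hb
      have hbs : ContDiff ℝ ∞ b := hda.comp hstep
      have hbM : ∀ i ≤ k, ∀ z, ‖iteratedFDeriv ℝ i b z‖ ≤ (1 + K * |h|) * M :=
        ih (E →L[ℝ] F) (fderiv ℝ a) M h hda
          (fun i hi z => by
            rw [norm_iteratedFDeriv_fderiv]; exact hM (i + 1) (by omega) z) hh
      have hbilin : ContDiff ℝ ∞ fun w => ContinuousLinearMap.compL ℝ E E F (b w) (fderiv ℝ X w) :=
        hbs.clm_comp hdX
      have hfd : fderiv ℝ (fun w => a (w + h • X w)) =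
          b + fun w => h • ContinuousLinearMap.compL ℝ E E F (b w) (fderiv ℝ X w) := by
        ext1 w
        have h1 : HasFDerivAt (fun w => w + h • X w)
            (ContinuousLinearMap.id ℝ E + h • fderiv ℝ X w) w :=
          (hasFDerivAt_id w).add (((hX.differentiable (by simp)) w).hasFDerivAt.const_smul h)
        have h2 := (((ha.differentiable (by simp)) (w + h • X w)).hasFDerivAt.comp w h1).fderiv
        rw [Function.comp_def] at h2
        rw [h2]
        ext v
        simp [hb]
      have hquad : ‖iteratedFDeriv ℝ j
          (fun w => ContinuousLinearMap.compL ℝ E E F (b w) (fderiv ℝ X w)) z‖ ≤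
          2 ^ k * ((1 + K) * M * S) := by
        refine (ContinuousLinearMap.norm_iteratedFDeriv_le_of_bilinear_of_le_one _ hbs hdX z
          (n := j) (mod_cast le_top) (ContinuousLinearMap.norm_compL_le ℝ E E F)).trans ?_
        calc _ ≤ ∑ i ∈ Finset.range (j + 1), (j.choose i : ℝ) * ((1 + K) * M * S) := by
              refine Finset.sum_le_sum fun i hi => ?_
              have hi' : i ≤ j := by simp at hi; omega
              rw [mul_assoc]
              gcongr
              · refine (hbM i (by omega) z).trans ?_
                gcongr
                exact mul_le_of_le_one_right hK hh
              · rw [norm_iteratedFDeriv_fderiv]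
                exact (hB _ z).trans (hBS (by omega))
          _ = 2 ^ j * ((1 + K) * M * S) := by
              rw [← Finset.sum_mul]
              exact_mod_cast congrArg (fun m : ℕ => (m : ℝ) * _) (Nat.sum_range_choose j)
          _ ≤ _ := by
              gcongr
              norm_num
      rw [← norm_iteratedFDeriv_fderiv, hfd, iteratedFDeriv_add_apply
        (hbs.contDiffAt.of_le (mod_cast le_top))
        ((hbilin.const_smul h).contDiffAt.of_le (mod_cast le_top)),
        iteratedFDeriv_const_smul_apply' (hbilin.contDiffAt.of_le (mod_cast le_top))]
      calc _ ≤ (1 + K * |h|) * M + |h| * (2 ^ k * ((1 + K) * M * S)) := by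
            refine (norm_add_le _ _).trans (add_le_add (hbM j hjk z) ?_)
            rw [norm_smul, Real.norm_eq_abs]
            gcongr
        _ = _ := by ring

/-- Derivative growth under composition with iterated Euler steps. -/
theorem exists_norm_iteratedFDeriv_comp_euler_iterate_le {X : E → E} (hX : ContDiff ℝ ∞ X)
    (hbdd : ∀ j, ∃ B, ∀ z, ‖iteratedFDeriv ℝ j X z‖ ≤ B) (k : ℕ) :
    ∃ K, 0 ≤ K ∧ ∀ (a : E → F) (M h : ℝ),
      ContDiff ℝ ∞ a → (∀ j ≤ k, ∀ z, ‖iteratedFDeriv ℝ j a z‖ ≤ M) → |h| ≤ 1 →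
      ∀ m : ℕ, ∀ j ≤ k, ∀ z,
        ‖iteratedFDeriv ℝ j (fun w => a ((fun y => y + h • X y)^[m] w)) z‖ ≤
          Real.exp (K * (m * |h|)) * M := by
  obtain ⟨K, hK, H⟩ := exists_norm_iteratedFDeriv_comp_euler_step_le hX hbdd k
  refine ⟨K, hK, fun a M h ha hM hh m => ?_⟩
  have hM0 : 0 ≤ M := (norm_nonneg _).trans (hM 0 (by omega) 0)
  have hstep : ContDiff ℝ ∞ fun w => w + h • X w := contDiff_id.add (hX.const_smul h)
  induction m with
  | zero => simpa using hM
  | succ m ih =>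
    intro j hj z
    simp only [Function.iterate_succ_apply]
    refine (H F _ _ h (ha.comp (contDiff_iterate hstep m)) ih hh j hj z).trans ?_
    rw [← mul_assoc]
    gcongr
    calc _ ≤ Real.exp (K * |h|) * Real.exp (K * (m * |h|)) := by
          gcongr
          linarith [Real.add_one_le_exp (K * |h|)]
      _ = _ := by rw [← Real.exp_add]; push_cast; ring_nf

/-- Convergence of the Euler scheme, with an explicit error. -/
theorem norm_integral_curve_sub_euler_iterate_le {X : E → E} {L B : ℝ} (hL0 : 0 ≤ L)
    (hL : ∀ x y, ‖X x - X y‖ ≤ L * ‖x - y‖) (hB : ∀ x, ‖X x‖ ≤ B) {γ : ℝ → E}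
    (hγ : ∀ t, HasDerivAt γ (X (γ t)) t) (h : ℝ) (m : ℕ) :
    ‖γ (m * h) - (fun y => y + h • X y)^[m] (γ 0)‖ ≤
      m * (L * B * h ^ 2) * Real.exp (L * |h| * m) := by
  have hB0 : 0 ≤ B := (norm_nonneg _).trans (hB 0)
  have hγL (s t : ℝ) : ‖γ t - γ s‖ ≤ B * |t - s| :=
    convex_univ.norm_image_sub_le_of_norm_hasDerivWithin_le
      (fun x _ => (hγ x).hasDerivWithinAt) (fun x _ => hB _) (Set.mem_univ _) (Set.mem_univ _)
  have htrunc (s : ℝ) : ‖γ (s + h) - γ s - h • X (γ s)‖ ≤ L * B * h ^ 2 := by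
    have hg (x : ℝ) : HasDerivAt (fun u => γ u - u • X (γ s)) (X (γ x) - X (γ s)) x := by
      simpa using! (hγ x).sub ((hasDerivAt_id x).smul_const (X (γ s)))
    have := (convex_uIcc s (s + h)).norm_image_sub_le_of_norm_hasDerivWithin_le
      (C := L * (B * |h|)) (fun x _ => (hg x).hasDerivWithinAt) (fun x hx => by
        refine (hL _ _).trans ?_
        gcongr
        refine (hγL s x).trans ?_
        exact mul_le_mul_of_nonneg_left (by simpa using Set.abs_sub_left_of_mem_uIcc hx) hB0)
      Set.left_mem_uIcc Set.right_mem_uIcc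
    calc _ = ‖γ (s + h) - (s + h) • X (γ s) - (γ s - s • X (γ s))‖ := by
          congr 1; rw [add_smul]; abel
      _ ≤ _ := this
      _ = _ := by rw [add_sub_cancel_left, Real.norm_eq_abs, ← sq_abs h]; ring
  induction m with
  | zero => simp
  | succ m ih =>
    rw [Function.iterate_succ_apply']
    set y := (fun y => y + h • X y)^[m] (γ 0)
    set s := (m : ℝ) * h
    have hs : ((m + 1 : ℕ) : ℝ) * h = s + h := by push_cast; ring
    set e := L * B * h ^ 2 with he
    have he0 : 0 ≤ e := by positivity
    calc _ = ‖(γ (s + h) - γ s - h • X (γ s)) + ((γ s - y) + h • (X (γ s) - X y))‖ := by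
          rw [hs, smul_sub]; congr 1; abel
      _ ≤ e + (‖γ s - y‖ + |h| * (L * ‖γ s - y‖)) := by
          refine (norm_add_le _ _).trans (add_le_add (htrunc s) ((norm_add_le _ _).trans ?_))
          rw [norm_smul, Real.norm_eq_abs]
          gcongr
          exact hL _ _
      _ = e + (1 + L * |h|) * ‖γ s - y‖ := by ring
      _ ≤ e * Real.exp (L * |h| * (m + 1)) +
          Real.exp (L * |h|) * (m * e * Real.exp (L * |h| * m)) := by
          gcongr
          · exact le_mul_of_one_le_right he0 (Real.one_le_exp (by positivity))
          · linarith [Real.add_one_le_exp (L * |h|)]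
      _ = _ := by
          push_cast; rw [mul_add (L * |h|), mul_one, Real.exp_add]; ring

variable {ι : Type*} {l : Filter ι}

/-- Pointwise convergence of functions with equi-Lipschitz derivatives forces pointwise convergence
of the derivatives. -/
theorem tendsto_fderiv_of_tendsto_of_lipschitz [FiniteDimensional ℝ E] {f : ι → E → F} {g : E → F}
    {M : ℝ} (hM : 0 ≤ M) (hf : ∀ i, Differentiable ℝ (f i)) {x : E} (hg : DifferentiableAt ℝ g x)
    (hfM : ∀ i y, ‖fderiv ℝ (f i) y - fderiv ℝ (f i) x‖ ≤ M * ‖y - x‖)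
    (hlim : ∀ y, Tendsto (fun i => f i y) l (𝓝 (g y))) :
    Tendsto (fun i => fderiv ℝ (f i) x) l (𝓝 (fderiv ℝ g x)) := by
  have key (v : E) : Tendsto (fun i => fderiv ℝ (f i) x v) l (𝓝 (fderiv ℝ g x v)) := by
    have htaylor (i) (w : E) : ‖f i (x + w) - f i x - fderiv ℝ (f i) x w‖ ≤ M * ‖w‖ * ‖w‖ := by
      have := (convex_closedBall x ‖w‖).norm_image_sub_le_of_norm_fderiv_le' (𝕜 := ℝ)
        (f := f i) (C := M * ‖w‖) (φ := fderiv ℝ (f i) x) (x := x) (y := x + w)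
        (fun y _ => hf i y) (fun y hy => (hfM i y).trans (by
          gcongr; simpa [dist_eq_norm] using hy)) (by simp) (by simp)
      simpa using this
    rw [Metric.tendsto_nhds]
    intro ε hε
    have h1 : ∀ᶠ s in 𝓝[>] (0 : ℝ), ‖s⁻¹ • (g (x + s • v) - g x) - fderiv ℝ g x v‖ < ε / 3 := by
      have := (hg.hasFDerivAt.hasLineDerivAt v).tendsto_slope_zero_right
      simpa [dist_eq_norm] using (Metric.tendsto_nhds.1 this) (ε / 3) (by positivity)
    have h2 : ∀ᶠ s in 𝓝[>] (0 : ℝ), s * (M * ‖v‖ * ‖v‖) < ε / 3 := by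
      have : Tendsto (fun s : ℝ => s * (M * ‖v‖ * ‖v‖)) (𝓝 0) (𝓝 (0 * (M * ‖v‖ * ‖v‖))) :=
        tendsto_id.mul_const _
      rw [zero_mul] at this
      exact (this.mono_left nhdsWithin_le_nhds).eventually_lt_const (by positivity)
    obtain ⟨s, hs1, hs2, hs⟩ := (h1.and (h2.and self_mem_nhdsWithin)).exists
    have hs : 0 < s := hs
    have h3 : Tendsto (fun i => s⁻¹ • (f i (x + s • v) - f i x)) l
        (𝓝 (s⁻¹ • (g (x + s • v) - g x))) := ((hlim _).sub (hlim _)).const_smul _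
    filter_upwards [(Metric.tendsto_nhds.1 h3) (ε / 3) (by positivity)] with i hi
    rw [dist_eq_norm] at hi ⊢
    have h4 : ‖s⁻¹ • (f i (x + s • v) - f i x) - fderiv ℝ (f i) x v‖ ≤ s * (M * ‖v‖ * ‖v‖) := by
      have h5 : s⁻¹ • (f i (x + s • v) - f i x) - fderiv ℝ (f i) x v =
          s⁻¹ • (f i (x + s • v) - f i x - fderiv ℝ (f i) x (s • v)) := by
        rw [map_smul, smul_sub _ _ (s • _), smul_smul, inv_mul_cancel₀ hs.ne', one_smul]
      rw [h5, norm_smul, norm_inv, Real.norm_eq_abs, abs_of_pos hs, inv_mul_le_iff₀ hs]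
      refine (htaylor i _).trans_eq ?_
      rw [norm_smul, Real.norm_eq_abs, abs_of_pos hs]
      ring
    calc _ = ‖-(s⁻¹ • (f i (x + s • v) - f i x) - fderiv ℝ (f i) x v) +
          ((s⁻¹ • (f i (x + s • v) - f i x) - s⁻¹ • (g (x + s • v) - g x)) +
          (s⁻¹ • (g (x + s • v) - g x) - fderiv ℝ g x v))‖ := by congr 1; abel
      _ ≤ _ := (norm_add_le _ _).trans (add_le_add_right (norm_add_le _ _) _)
      _ < ε := by rw [norm_neg]; linarith
  let e : (E →L[ℝ] F) ≃L[ℝ] Fin (Module.finrank ℝ E) → F :=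
    ((ContinuousLinearEquiv.ofFinrankEq (Module.finrank_fin_fun ℝ).symm).arrowCongr
      (1 : F ≃L[ℝ] F)).trans (ContinuousLinearEquiv.piRing _)
  rw [e.toHomeomorph.isInducing.tendsto_nhds_iff]
  exact tendsto_pi_nhds.mpr fun i => key _

/-- Bounds on derivatives up to order `k` pass to smooth pointwise limits when the derivatives up
to order `k + 1` are uniformly bounded. -/
theorem norm_iteratedFDeriv_le_of_tendsto [FiniteDimensional ℝ E] [l.NeBot] (k : ℕ) :
    ∀ (F : Type) [NormedAddCommGroup F] [NormedSpace ℝ F] (f : ι → E → F) (g : E → F) (M M' : ℝ),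
      (∀ i, ContDiff ℝ ∞ (f i)) → ContDiff ℝ ∞ g →
      (∀ y, Tendsto (fun i => f i y) l (𝓝 (g y))) →
      (∀ i, ∀ j ≤ k, ∀ z, ‖iteratedFDeriv ℝ j (f i) z‖ ≤ M) →
      (∀ i, ∀ j ≤ k + 1, ∀ z, ‖iteratedFDeriv ℝ j (f i) z‖ ≤ M') →
      ∀ j ≤ k, ∀ z, ‖iteratedFDeriv ℝ j g z‖ ≤ M := by
  induction k with
  | zero =>
    intro F _ _ f g M M' hf hg hlim hM hM' j hj z
    obtain rfl : j = 0 := by omega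
    simp only [Nat.le_zero, forall_eq, norm_iteratedFDeriv_zero] at hM ⊢
    exact le_of_tendsto (hlim z).norm (Eventually.of_forall fun i => hM i z)
  | succ k ih =>
    intro F _ _ f g M M' hf hg hlim hM hM' j hj z
    cases j with
    | zero =>
      rw [norm_iteratedFDeriv_zero]
      exact le_of_tendsto (hlim z).norm (Eventually.of_forall fun i => by
        simpa using hM i 0 (by omega) z)
    | succ j =>
      have hdf (i) : ContDiff ℝ ∞ (fderiv ℝ (f i)) := (hf i).fderiv_right (by simp)
      obtain ⟨i₀⟩ := l.nonempty_of_neBot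
      have hM'nonneg : 0 ≤ M' := (norm_nonneg _).trans (hM' i₀ 0 (by omega) 0)
      rw [← norm_iteratedFDeriv_fderiv]
      refine ih (E →L[ℝ] F) (fun i => fderiv ℝ (f i)) (fderiv ℝ g) M M' hdf
        (hg.fderiv_right (by simp)) (fun y => ?_) ?_ ?_ j (by omega) z
      · refine tendsto_fderiv_of_tendsto_of_lipschitz hM'nonneg
          (fun i => (hf i).differentiable (by simp)) (hg.differentiable (by simp) y) (fun i w => ?_)
          hlim
        refine convex_univ.norm_image_sub_le_of_norm_fderiv_le (𝕜 := ℝ)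
          (fun x _ => (hdf i).differentiable (by simp) x) (fun x _ => ?_) (Set.mem_univ _)
          (Set.mem_univ _)
        rw [← norm_iteratedFDeriv_one, norm_iteratedFDeriv_fderiv]
        exact hM' i 2 (by omega) x
      · intro i j hj z
        rw [norm_iteratedFDeriv_fderiv]
        exact hM i (j + 1) (by omega) z
      · intro i j hj z
        rw [norm_iteratedFDeriv_fderiv]
        exact hM' i (j + 1) (by omega) z

/-- The Euler scheme with `m N` equal steps on `[0, t]` converges to the integral curve as
`m N → ∞`. -/
theorem tendsto_euler_iterate {X : E → E} {L B : ℝ} (hL0 : 0 ≤ L)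
    (hL : ∀ x y, ‖X x - X y‖ ≤ L * ‖x - y‖) (hB : ∀ x, ‖X x‖ ≤ B) {γ : ℝ → E}
    (hγ : ∀ t, HasDerivAt γ (X (γ t)) t) (t : ℝ) {m : ℕ → ℕ} (hm0 : ∀ N, m N ≠ 0)
    (hm : Tendsto m atTop atTop) :
    Tendsto (fun N => (fun y => y + (t / m N) • X y)^[m N] (γ 0)) atTop (𝓝 (γ t)) := by
  rw [tendsto_iff_norm_sub_tendsto_zero]
  have hlim : Tendsto (fun N => L * B * t ^ 2 * Real.exp (L * |t|) / (m N : ℝ)) atTop (𝓝 0) :=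
    (tendsto_natCast_atTop_atTop.comp hm).const_div_atTop _
  refine squeeze_zero (fun _ => norm_nonneg _) (fun N => ?_) hlim
  have hN : (m N : ℝ) ≠ 0 := Nat.cast_ne_zero.2 (hm0 N)
  have := norm_integral_curve_sub_euler_iterate_le hL0 hL hB hγ (t / m N) (m N)
  rw [mul_div_cancel₀ _ hN, norm_sub_rev] at this
  refine this.trans_eq ?_
  rw [abs_div, Nat.abs_cast, mul_assoc L (_ / _), div_mul_cancel₀ _ hN]
  field_simp

end

/-- Exponential growth bound on derivatives of classically transported
observables: for the flow `Φ` of a smooth compactly supported vector field, the `C^k` norms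
of `a ∘ Φ^t` grow at most like `e^{Γ|t|}` times the `C^k` norms of `a`. -/
theorem transported_observable_derivative_growth
    (n : ℕ) (hn : 1 ≤ n)
    (X : (Fin n → ℝ) → (Fin n → ℝ)) (hX : ContDiff ℝ (⊤ : ℕ∞) X) (hXc : HasCompactSupport X)
    (Φ : ℝ → (Fin n → ℝ) → (Fin n → ℝ))
    (hΦ0 : Φ 0 = id)
    (hΦflow : ∀ (z : Fin n → ℝ) (t : ℝ), HasDerivAt (fun s => Φ s z) (X (Φ t z)) t)
    (hΦsmooth : ∀ t : ℝ, ContDiff ℝ (⊤ : ℕ∞) (Φ t)) :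
    ∀ k : ℕ, ∃ C Γ : ℝ, 0 < C ∧ 0 < Γ ∧
      ∀ (a : (Fin n → ℝ) → ℂ), ContDiff ℝ (⊤ : ℕ∞) a → HasCompactSupport a →
        ∀ t : ℝ,
          (∑ j ∈ Finset.range (k + 1),
              ⨆ z : Fin n → ℝ, ‖iteratedFDeriv ℝ j (fun w => a (Φ t w)) z‖)
            ≤ C * Real.exp (Γ * |t|) *
              ∑ j ∈ Finset.range (k + 1), ⨆ z : Fin n → ℝ, ‖iteratedFDeriv ℝ j a z‖ := by
  intro k
  have hXbdd (j : ℕ) : ∃ B, ∀ z, ‖iteratedFDeriv ℝ j X z‖ ≤ B :=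
    (hX.continuous_iteratedFDeriv (mod_cast le_top)).bounded_above_of_compact_support
      (hXc.iteratedFDeriv j)
  obtain ⟨B, hB⟩ := hX.continuous.bounded_above_of_compact_support hXc
  obtain ⟨L, hL⟩ := hX.lipschitzWith_of_hasCompactSupport hXc (by simp)
  obtain ⟨K, hK, H⟩ := exists_norm_iteratedFDeriv_comp_euler_iterate_le (F := ℂ) hX hXbdd k
  obtain ⟨K', -, H'⟩ :=
    exists_norm_iteratedFDeriv_comp_euler_iterate_le (F := ℂ) hX hXbdd (k + 1)
  refine ⟨k + 1, K + 1, by positivity, by positivity, fun a ha hac t => ?_⟩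
  have habdd (j : ℕ) : BddAbove (Set.range fun z => ‖iteratedFDeriv ℝ j a z‖) :=
    (ha.continuous_iteratedFDeriv (mod_cast le_top)).norm.bddAbove_range_of_hasCompactSupport
      (hac.iteratedFDeriv j).norm
  have haM (k j : ℕ) (hj : j ≤ k) (z : Fin n → ℝ) : ‖iteratedFDeriv ℝ j a z‖ ≤
      ∑ j ∈ Finset.range (k + 1), ⨆ z, ‖iteratedFDeriv ℝ j a z‖ :=
    (le_ciSup (habdd j) z).trans (Finset.single_le_sum
      (f := fun j => ⨆ z, ‖iteratedFDeriv ℝ j a z‖)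
      (fun i _ => Real.iSup_nonneg fun _ => norm_nonneg _) (by simp; omega))
  set M := ∑ j ∈ Finset.range (k + 1), ⨆ z, ‖iteratedFDeriv ℝ j a z‖
  have hM0 : 0 ≤ M := Finset.sum_nonneg fun i _ => Real.iSup_nonneg fun _ => norm_nonneg _
  let m : ℕ → ℕ := fun N => N + (⌈|t|⌉₊ + 1)
  have hm0 (N) : m N ≠ 0 := by simp [m]
  have hm : Tendsto m atTop atTop := tendsto_add_atTop_nat _
  have hmpos (N) : (0 : ℝ) < m N := Nat.cast_pos.2 (Nat.pos_of_ne_zero (hm0 N))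
  have hmt (N) : |t / m N| ≤ 1 := by
    rw [abs_div, Nat.abs_cast, div_le_one (hmpos N)]
    exact (Nat.le_ceil _).trans (Nat.cast_le.2 (by simp only [m]; omega))
  have hmul (N) : (m N : ℝ) * |t / m N| = |t| := by
    rw [abs_div, Nat.abs_cast, mul_div_cancel₀ _ (hmpos N).ne']
  have hlim (z : Fin n → ℝ) :
      Tendsto (fun N => a ((fun y => y + (t / m N) • X y)^[m N] z)) atTop (𝓝 (a (Φ t z))) := by
    have := tendsto_euler_iterate L.coe_nonneg (fun x y => hL.norm_sub_le x y) hB (hΦflow z) t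
      hm0 hm
    simp only [hΦ0, id] at this
    exact (ha.continuous.tendsto _).comp this
  have hbound (j : ℕ) (hj : j ≤ k) (z : Fin n → ℝ) :
      ‖iteratedFDeriv ℝ j (fun w => a (Φ t w)) z‖ ≤ Real.exp (K * |t|) * M := by
    refine norm_iteratedFDeriv_le_of_tendsto (l := atTop) k ℂ
      (fun N w => a ((fun y => y + (t / m N) • X y)^[m N] w)) _ _
      (Real.exp (K' * |t|) * ∑ j ∈ Finset.range (k + 2), ⨆ z, ‖iteratedFDeriv ℝ j a z‖)
      (fun N => ha.comp (contDiff_iterate (contDiff_id.add (hX.const_smul _)) _))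
      (ha.comp (hΦsmooth t)) hlim (fun N => ?_) (fun N => ?_) j hj z
    · simpa only [hmul] using H a M (t / m N) ha (haM k) (hmt N) (m N)
    · simpa only [hmul] using H' a _ (t / m N) ha (haM (k + 1)) (hmt N) (m N)
  calc _ ≤ ∑ j ∈ Finset.range (k + 1), Real.exp (K * |t|) * M :=
        Finset.sum_le_sum fun j hj => ciSup_le (hbound j (by simp at hj; omega))
    _ = (k + 1) * Real.exp (K * |t|) * M := by simp [mul_assoc]
    _ ≤ _ := by
        gcongr
        linarith
end
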